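/- arXiv:2303.18161 — 12 statements merged into one kernel-verified Lean document; each statement's English description precedes it below -/
import Mathlib

section
/- Assume nσ² − 2δ_jα > 0 for all j = 1,…,n and ŝ(α) ≠ 1. Then the CARA best-response system has exactly one solution π ∈ ℝⁿ, and it is given componentwise by π_i = (n/(n+θ_i))·(nδ_iμ/(nσ² − δ_iα)) + (θ_i/(n+θ_i) + nαδ_i/((n+θ_i)(nσ² − δ_iα)))·[Σ_{j=1}^n (n/(n+θ_j))·(nδ_j/(nσ² − δ_jα))·μ]/(1 − ŝ(α)) for every i = 1,…,n. -/
open Finset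

/-- An affine system in which every coordinate depends only on the sum of all coordinates has
exactly one solution, provided the coefficients of the sum do not add up to one. -/
lemma forall_eq_add_mul_sum_iff {ι K : Type*} [Fintype ι] [Field K] (a b x : ι → K)
    (hb : ∑ i, b i ≠ 1) :
    (∀ i, x i = a i + b i * ∑ j, x j) ↔
      x = fun i => a i + b i * ((∑ j, a j) / (1 - ∑ j, b j)) := by
  have hb' : 1 - ∑ j, b j ≠ 0 := sub_ne_zero.mpr hb.symm
  constructor
  · intro h
    have hsum : ∑ j, x j = ∑ j, a j + (∑ j, b j) * ∑ j, x j := by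
      conv_lhs => rw [Finset.sum_congr rfl fun i _ => h i]
      rw [Finset.sum_add_distrib, Finset.sum_mul]
    have hx : ∑ j, x j = (∑ j, a j) / (1 - ∑ j, b j) := by
      rw [eq_div_iff hb']
      linear_combination hsum
    funext i
    rw [← hx]
    exact h i
  · intro h
    have hx : ∑ j, x j = (∑ j, a j) / (1 - ∑ j, b j) := by
      rw [h, Finset.sum_add_distrib, ← Finset.sum_mul]
      field_simp
      ring
    intro i
    rw [hx]
    exact congrFun h i

/-- A single CARA best-response equation, rewritten in terms of the aggregate position `S`. -/
lemma cara_best_response_iff {n θ δ α μ v p S : ℝ} (hn : n ≠ 0) (hθ : n + θ ≠ 0)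
    (hD : v - 2 * δ * α ≠ 0) (hE : v - δ * α ≠ 0) :
    p - θ / n * (S - p) =
        n * δ * μ / (v - 2 * δ * α) + δ * α / (v - 2 * δ * α) * ((n + θ) / n) * (S - p) ↔
      p = n / (n + θ) * (n * δ * μ / (v - δ * α)) +
        (θ / (n + θ) + n * α * δ / ((n + θ) * (v - δ * α))) * S := by
  generalize hd : v - 2 * δ * α = d at *
  obtain rfl : v = d + 2 * δ * α := by rw [← hd]; ring
  rw [show d + 2 * δ * α - δ * α = d + δ * α by ring] at *
  have key : (p - θ / n * (S - p) - (n * δ * μ / d +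
        δ * α / d * ((n + θ) / n) * (S - p))) * (n * d) =
      (p - (n / (n + θ) * (n * δ * μ / (d + δ * α)) +
        (θ / (n + θ) + n * α * δ / ((n + θ) * (d + δ * α))) * S)) *
        ((n + θ) * (d + δ * α)) := by
    field_simp
    ring
  rw [← sub_eq_zero, ← mul_eq_zero_iff_right (mul_ne_zero hn hD), key,
    mul_eq_zero_iff_right (mul_ne_zero hθ hE), sub_eq_zero]

/-- Unique constant Nash equilibrium of the CARA relative-performance game with
linear price impact: under `nσ² − 2δⱼα > 0` and `ŝ(α) ≠ 1`, the CARA best-response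
system has exactly one solution, given by the stated formula. -/
theorem cara_unique_nash
    (n : ℕ) (hn : 1 ≤ n) (μ σ α : ℝ) (hμ : 0 < μ) (hσ : 0 < σ)
    (δ θ : Fin n → ℝ) (hδ : ∀ i, 0 < δ i) (hθ : ∀ i, 0 ≤ θ i ∧ θ i ≤ 1)
    (hpos : ∀ j, 0 < (n : ℝ) * σ ^ 2 - 2 * δ j * α)
    (hs : (∑ j, θ j / ((n : ℝ) + θ j)) +
        ∑ j, (n : ℝ) * α * δ j / (((n : ℝ) + θ j) * ((n : ℝ) * σ ^ 2 - δ j * α)) ≠ 1) :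
    ∀ π : Fin n → ℝ,
      (∀ i, π i - θ i / (n : ℝ) * ∑ j ∈ Finset.univ.erase i, π j =
          (n : ℝ) * δ i * μ / ((n : ℝ) * σ ^ 2 - 2 * δ i * α) +
            δ i * α / ((n : ℝ) * σ ^ 2 - 2 * δ i * α) * (((n : ℝ) + θ i) / (n : ℝ)) *
              ∑ j ∈ Finset.univ.erase i, π j)
        ↔ π = fun i =>
            (n : ℝ) / ((n : ℝ) + θ i) * ((n : ℝ) * δ i * μ / ((n : ℝ) * σ ^ 2 - δ i * α)) +
              (θ i / ((n : ℝ) + θ i) +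
                  (n : ℝ) * α * δ i / (((n : ℝ) + θ i) * ((n : ℝ) * σ ^ 2 - δ i * α))) *
                ((∑ j, (n : ℝ) / ((n : ℝ) + θ j) *
                    ((n : ℝ) * δ j / ((n : ℝ) * σ ^ 2 - δ j * α)) * μ) /
                  (1 - ((∑ j, θ j / ((n : ℝ) + θ j)) +
                    ∑ j, (n : ℝ) * α * δ j /
                      (((n : ℝ) + θ j) * ((n : ℝ) * σ ^ 2 - δ j * α))))) := by
  intro π
  have hn' : (0 : ℝ) < n := by exact_mod_cast hn
  have hE : ∀ j, 0 < (n : ℝ) * σ ^ 2 - δ j * α := fun j => by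
    have : 0 < (n : ℝ) * σ ^ 2 := by positivity
    linarith [hpos j]
  have hθ' : ∀ j, 0 < (n : ℝ) + θ j := fun j => by linarith [(hθ j).1]
  have hsum : ∀ i, ∑ j ∈ Finset.univ.erase i, π j = ∑ j, π j - π i := fun i =>
    Finset.sum_erase_eq_sub (Finset.mem_univ i)
  have ha : ∑ j, (n : ℝ) / ((n : ℝ) + θ j) *
        ((n : ℝ) * δ j / ((n : ℝ) * σ ^ 2 - δ j * α)) * μ =
      ∑ j, (n : ℝ) / ((n : ℝ) + θ j) * ((n : ℝ) * δ j * μ / ((n : ℝ) * σ ^ 2 - δ j * α)) :=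
    Finset.sum_congr rfl fun j _ => by ring
  rw [← Finset.sum_add_distrib] at hs ⊢
  rw [ha, ← forall_eq_add_mul_sum_iff _ _ π hs]
  refine forall_congr' fun i => ?_
  rw [hsum i]
  exact cara_best_response_iff hn'.ne' (hθ' i).ne' (hpos i).ne' (hE i).ne'
end

section
/- Assume nσ² − 2δ_jα > 0 for all j = 1,…,n and ŝ(α) = 1. Then the CARA best-response system has no solution π ∈ ℝⁿ; in particular there is no constant Nash equilibrium. -/
open Finset

/-- If `nσ² − 2δⱼα > 0` for all agents and `ŝ(α) = 1`, the CARA best-response system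
has no solution, i.e. there is no constant Nash equilibrium. -/
theorem cara_no_nash
    (n : ℕ) (hn : 1 ≤ n) (μ σ α : ℝ) (hμ : 0 < μ) (hσ : 0 < σ)
    (δ θ : Fin n → ℝ) (hδ : ∀ i, 0 < δ i) (hθ : ∀ i, 0 ≤ θ i ∧ θ i ≤ 1)
    (hpos : ∀ j, 0 < (n : ℝ) * σ ^ 2 - 2 * δ j * α)
    (hs : (∑ j, θ j / ((n : ℝ) + θ j)) +
        ∑ j, (n : ℝ) * α * δ j / (((n : ℝ) + θ j) * ((n : ℝ) * σ ^ 2 - δ j * α)) = 1) :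
    ¬ ∃ π : Fin n → ℝ,
      ∀ i, π i - θ i / (n : ℝ) * ∑ j ∈ Finset.univ.erase i, π j =
          (n : ℝ) * δ i * μ / ((n : ℝ) * σ ^ 2 - 2 * δ i * α) +
            δ i * α / ((n : ℝ) * σ ^ 2 - 2 * δ i * α) * (((n : ℝ) + θ i) / (n : ℝ)) *
              ∑ j ∈ Finset.univ.erase i, π j := by
  rintro ⟨π, hπ⟩
  have hn0 : (0 : ℝ) < n := by exact_mod_cast hn
  have hE : ∀ i, 0 < (n : ℝ) * σ ^ 2 - δ i * α := fun i => by
    have := hpos i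
    have : 0 < (n : ℝ) * σ ^ 2 := by positivity
    linarith
  have hθn : ∀ i, 0 < (n : ℝ) + θ i := fun i => by linarith [(hθ i).1]
  have hsolve : ∀ i, π i =
      (n : ℝ) ^ 2 * δ i * μ / (((n : ℝ) + θ i) * ((n : ℝ) * σ ^ 2 - δ i * α)) +
        (θ i / ((n : ℝ) + θ i) +
          (n : ℝ) * α * δ i / (((n : ℝ) + θ i) * ((n : ℝ) * σ ^ 2 - δ i * α))) *
          ∑ j, π j := fun i => by
    have h := hπ i
    have hD : (n : ℝ) * σ ^ 2 - δ i * 2 * α ≠ 0 := by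
      rw [mul_comm (δ i) 2]
      exact (hpos i).ne'
    have hEi := (hE i).ne'
    have hti := (hθn i).ne'
    rw [Finset.sum_erase_eq_sub (Finset.mem_univ i)] at h
    generalize ∑ j, π j = S at h ⊢
    field_simp at h ⊢
    linear_combination h
  have hsum : ∑ i, π i =
      ∑ i, (n : ℝ) ^ 2 * δ i * μ / (((n : ℝ) + θ i) * ((n : ℝ) * σ ^ 2 - δ i * α)) +
        ∑ i, π i := by
    conv_lhs => rw [Finset.sum_congr rfl fun i _ => hsolve i]
    rw [Finset.sum_add_distrib, ← Finset.sum_mul, Finset.sum_add_distrib, hs, one_mul]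
  have hlt : 0 <
      ∑ i, (n : ℝ) ^ 2 * δ i * μ / (((n : ℝ) + θ i) * ((n : ℝ) * σ ^ 2 - δ i * α)) := by
    refine Finset.sum_pos (fun i _ => ?_) ⟨⟨0, hn⟩, Finset.mem_univ _⟩
    have := hδ i
    exact div_pos (by positivity) (mul_pos (hθn i) (hE i))
  linarith
end

section
/- Assume nσ² − 2δ_jα > 0 for all j = 1,…,n and ŝ(α) ≠ 1. Then every solution π ∈ ℝⁿ of the CARA best-response system satisfies Σ_{j=1}^n π_j = [Σ_{j=1}^n (n/(n+θ_j))·(nδ_j/(nσ² − δ_jα))·μ]/(1 − ŝ(α)). -/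
open Finset

/-- Aggregate investment in equilibrium: every solution of the CARA best-response
system has total investment `[Σⱼ (n/(n+θⱼ))·(nδⱼ/(nσ²−δⱼα))·μ] / (1 − ŝ(α))`. -/
theorem cara_sum_of_equilibrium
    (n : ℕ) (hn : 1 ≤ n) (μ σ α : ℝ) (hμ : 0 < μ) (hσ : 0 < σ)
    (δ θ : Fin n → ℝ) (hδ : ∀ i, 0 < δ i) (hθ : ∀ i, 0 ≤ θ i ∧ θ i ≤ 1)
    (hpos : ∀ j, 0 < (n : ℝ) * σ ^ 2 - 2 * δ j * α)
    (hs : (∑ j, θ j / ((n : ℝ) + θ j)) +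
        ∑ j, (n : ℝ) * α * δ j / (((n : ℝ) + θ j) * ((n : ℝ) * σ ^ 2 - δ j * α)) ≠ 1)
    (π : Fin n → ℝ)
    (hπ : ∀ i, π i - θ i / (n : ℝ) * ∑ j ∈ Finset.univ.erase i, π j =
        (n : ℝ) * δ i * μ / ((n : ℝ) * σ ^ 2 - 2 * δ i * α) +
          δ i * α / ((n : ℝ) * σ ^ 2 - 2 * δ i * α) * (((n : ℝ) + θ i) / (n : ℝ)) *
            ∑ j ∈ Finset.univ.erase i, π j) :
    ∑ j, π j =
      (∑ j, (n : ℝ) / ((n : ℝ) + θ j) * ((n : ℝ) * δ j / ((n : ℝ) * σ ^ 2 - δ j * α)) * μ) /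
        (1 - ((∑ j, θ j / ((n : ℝ) + θ j)) +
          ∑ j, (n : ℝ) * α * δ j / (((n : ℝ) + θ j) * ((n : ℝ) * σ ^ 2 - δ j * α)))) := by
  have hn' : (0 : ℝ) < n := by exact_mod_cast hn
  set S := ∑ j, π j with hS
  have key : ∀ i, π i =
      (n : ℝ) / ((n : ℝ) + θ i) * ((n : ℝ) * δ i / ((n : ℝ) * σ ^ 2 - δ i * α)) * μ +
        (θ i / ((n : ℝ) + θ i) +
          (n : ℝ) * α * δ i / (((n : ℝ) + θ i) * ((n : ℝ) * σ ^ 2 - δ i * α))) * S := by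
    intro i
    have h := hπ i
    rw [Finset.sum_erase_eq_sub (Finset.mem_univ i), ← hS] at h
    have hA := hpos i
    have hT : 0 < (n : ℝ) + θ i := add_pos_of_pos_of_nonneg hn' (hθ i).1
    have hB : 0 < (n : ℝ) * σ ^ 2 - δ i * α := by
      have : 0 < (n : ℝ) * σ ^ 2 := by positivity
      linarith
    have hA' := hA.ne'
    have hB' := hB.ne'
    obtain ⟨A, hAdef⟩ : ∃ A, A = (n : ℝ) * σ ^ 2 - 2 * δ i * α := ⟨_, rfl⟩
    have hBA : (n : ℝ) * σ ^ 2 - δ i * α = A + δ i * α := by rw [hAdef]; ring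
    rw [hBA] at hB' ⊢
    rw [← hAdef] at h hA'
    field_simp at h ⊢
    linear_combination h
  have hsum : S = (∑ j, (n : ℝ) / ((n : ℝ) + θ j) *
        ((n : ℝ) * δ j / ((n : ℝ) * σ ^ 2 - δ j * α)) * μ) +
      ((∑ j, θ j / ((n : ℝ) + θ j)) +
        ∑ j, (n : ℝ) * α * δ j / (((n : ℝ) + θ j) * ((n : ℝ) * σ ^ 2 - δ j * α))) * S := by
    rw [← Finset.sum_add_distrib, Finset.sum_mul, ← Finset.sum_add_distrib]
    exact Finset.sum_congr rfl fun i _ => key i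
  rw [eq_div_iff (sub_ne_zero.mpr hs.symm)]
  linear_combination hsum
end

section
/- Assume n ≥ 2. Then there exists exactly one α_0 ∈ (0, α_max) with ŝ(α_0) = 1, where α_max = nσ²/(2·max_j δ_j); moreover α_0 is the unique solution of ŝ(α) = 1 in all of (−∞, α_max]. -/
open Finset

/-- The map `x ↦ k x / (a (c - x))` is strictly increasing below its pole. -/
lemma mul_div_mul_sub_lt {k a c x y : ℝ} (hk : 0 < k) (ha : 0 < a) (hc : 0 < c)
    (hxy : x < y) (hy : y < c) :
    k * x / (a * (c - x)) < k * y / (a * (c - y)) := by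
  have hx' : 0 < c - x := by linarith
  have hy' : 0 < c - y := by linarith
  rw [div_lt_div_iff₀ (by positivity) (by positivity)]
  have h : 0 < k * a * c * (y - x) := by
    have := sub_pos.2 hxy
    positivity
  linarith

/-- Existence and uniqueness of the critical price impact `α₀`: for `n ≥ 2` there is
exactly one `α₀ ∈ (0, α_max)` with `ŝ(α₀) = 1`, and it is the unique solution of
`ŝ(α) = 1` in all of `(−∞, α_max]`, where `α_max = nσ²/(2·maxⱼ δⱼ)`. -/
theorem shat_unique_root
    (n : ℕ) (hn : 2 ≤ n) (σ : ℝ) (hσ : 0 < σ)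
    (δ θ : Fin n → ℝ) (hδ : ∀ j, 0 < δ j) (hθ : ∀ j, 0 ≤ θ j ∧ θ j ≤ 1)
    (δmax : ℝ) (hδmax : IsGreatest (Set.range δ) δmax) :
    ∃! α₀ : ℝ, α₀ ∈ Set.Ioo (0 : ℝ) ((n : ℝ) * σ ^ 2 / (2 * δmax)) ∧
      ((∑ j, θ j / ((n : ℝ) + θ j)) +
        ∑ j, (n : ℝ) * α₀ * δ j / (((n : ℝ) + θ j) * ((n : ℝ) * σ ^ 2 - δ j * α₀)) = 1) ∧
      ∀ α ∈ Set.Iic ((n : ℝ) * σ ^ 2 / (2 * δmax)),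
        ((∑ j, θ j / ((n : ℝ) + θ j)) +
          ∑ j, (n : ℝ) * α * δ j / (((n : ℝ) + θ j) * ((n : ℝ) * σ ^ 2 - δ j * α)) = 1) →
        α = α₀ := by
  have hn' : (2 : ℝ) ≤ n := by exact_mod_cast hn
  have hn0 : (0 : ℝ) < n := by linarith
  obtain ⟨⟨m, hm⟩, hub⟩ := hδmax
  have hle : ∀ j, δ j ≤ δmax := fun j => hub ⟨j, rfl⟩
  have hδm : 0 < δmax := hm ▸ hδ m
  have hden : ∀ j, 0 < (n : ℝ) + θ j := fun j => by linarith [(hθ j).1]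
  set c : ℝ := (n : ℝ) * σ ^ 2 with hc
  have hc0 : 0 < c := by positivity
  set M : ℝ := c / (2 * δmax) with hM
  have hM0 : 0 < M := by positivity
  have hMδ : δmax * M = c / 2 := by rw [hM]; field_simp
  have hpole : ∀ α ≤ M, ∀ j, δ j * α < c := fun α hα j => by
    have h₁ : δ j * α ≤ δ j * M := mul_le_mul_of_nonneg_left hα (hδ j).le
    have h₂ : δ j * M ≤ δmax * M := mul_le_mul_of_nonneg_right (hle j) hM0.le
    linarith
  set f : ℝ → ℝ := fun α => (∑ j, θ j / ((n : ℝ) + θ j)) +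
    ∑ j, (n : ℝ) * α * δ j / (((n : ℝ) + θ j) * (c - δ j * α)) with hf
  have hmono : StrictMonoOn f (Set.Iic M) := by
    intro x _ y hy hxy
    refine add_lt_add_right (sum_lt_sum_of_nonempty ⟨m, mem_univ m⟩ fun j _ => ?_) _
    have h := mul_div_mul_sub_lt hn0 (hden j) hc0
      (mul_lt_mul_of_pos_left hxy (hδ j)) (hpole y hy j)
    simpa only [mul_assoc, mul_comm (δ j)] using h
  have hcont : ContinuousOn f (Set.Icc 0 M) := by
    refine continuousOn_const.add (continuousOn_finsetSum _ fun j _ => ?_)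
    refine ContinuousOn.div (by fun_prop) (by fun_prop) fun x hx => ?_
    exact (mul_pos (hden j) (sub_pos.2 (hpole x hx.2 j))).ne'
  have hzero : f 0 < 1 := by
    have h : ∑ j, θ j / ((n : ℝ) + θ j) ≤ ∑ _j : Fin n, 1 / ((n : ℝ) + 1) :=
      sum_le_sum fun j _ => by
        rw [div_le_div_iff₀ (hden j) (by positivity)]
        nlinarith [(hθ j).2]
    have h' : ∑ _j : Fin n, 1 / ((n : ℝ) + 1) < 1 := by
      rw [sum_const, card_univ, Fintype.card_fin, nsmul_eq_mul, mul_one_div,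
        div_lt_one (by positivity)]
      linarith
    simpa [hf] using h.trans_lt h'
  have hmax : 1 < f M := by
    have hterm : θ m / ((n : ℝ) + θ m) +
        (n : ℝ) * M * δ m / (((n : ℝ) + θ m) * (c - δ m * M)) = 1 := by
      have hne := (hden m).ne'
      rw [mul_assoc, mul_comm M, hm, hMδ, sub_half]
      field_simp
      ring
    have hpos : ∀ j, 0 < θ j / ((n : ℝ) + θ j) +
        (n : ℝ) * M * δ j / (((n : ℝ) + θ j) * (c - δ j * M)) := fun j =>
      add_pos_of_nonneg_of_pos (div_nonneg (hθ j).1 (hden j).le)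
        (div_pos (mul_pos (mul_pos hn0 hM0) (hδ j))
          (mul_pos (hden j) (sub_pos.2 (hpole M le_rfl j))))
    have : Nontrivial (Fin n) := Fin.nontrivial_iff_two_le.2 hn
    obtain ⟨i, hi⟩ := exists_ne m
    have hlt := single_lt_sum hi (mem_univ m) (mem_univ i) (hpos i)
      fun j _ _ => (hpos j).le
    rw [hterm, sum_add_distrib] at hlt
    exact hlt
  obtain ⟨α₀, hα₀, hroot⟩ := intermediate_value_Ioo hM0.le hcont ⟨hzero, hmax⟩
  have huniq : ∀ α ∈ Set.Iic M, f α = 1 → α = α₀ := fun α hα h =>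
    hmono.injOn hα (Set.mem_Iic.2 hα₀.2.le) (h.trans hroot.symm)
  exact ⟨α₀, ⟨hα₀, hroot, huniq⟩, fun β hβ => huniq β hβ.1.2.le hβ.2.1⟩
end

section
/- Assume nσ² − 2δ_jα > 0 for all j = 1,…,n and ŝ(α) ≠ 1, and let π* be the candidate equilibrium. Then π_i* > 0 for all i = 1,…,n if and only if ŝ(α) < 1. -/
open Finset

/-- The sum of the competition ratios `θⱼ / (n + θⱼ)` stays strictly below one. -/
lemma sum_div_natCast_add_lt_one (n : ℕ) (hn : 1 ≤ n) (θ : Fin n → ℝ)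
    (hθ : ∀ i, 0 ≤ θ i ∧ θ i ≤ 1) : ∑ j, θ j / ((n : ℝ) + θ j) < 1 := by
  have hn' : (1 : ℝ) ≤ n := by exact_mod_cast hn
  calc ∑ j, θ j / ((n : ℝ) + θ j) ≤ ∑ _j : Fin n, 1 / ((n : ℝ) + 1) := by
        refine Finset.sum_le_sum fun j _ => ?_
        have := hθ j
        rw [div_le_div_iff₀ (by linarith) (by linarith)]
        nlinarith
    _ = n / ((n : ℝ) + 1) := by simp [div_eq_mul_inv]
    _ < 1 := by rw [div_lt_one (by linarith)]; linarith

/-- Positivity of the candidate CARA equilibrium: all components `πᵢ*` are strictly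
positive if and only if `ŝ(α) < 1`. -/
theorem cara_equilibrium_positive_iff
    (n : ℕ) (hn : 1 ≤ n) (μ σ α : ℝ) (hμ : 0 < μ) (hσ : 0 < σ)
    (δ θ : Fin n → ℝ) (hδ : ∀ i, 0 < δ i) (hθ : ∀ i, 0 ≤ θ i ∧ θ i ≤ 1)
    (hpos : ∀ j, 0 < (n : ℝ) * σ ^ 2 - 2 * δ j * α)
    (hs : (∑ j, θ j / ((n : ℝ) + θ j)) +
        ∑ j, (n : ℝ) * α * δ j / (((n : ℝ) + θ j) * ((n : ℝ) * σ ^ 2 - δ j * α)) ≠ 1) :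
    (∀ i,
        0 < (n : ℝ) / ((n : ℝ) + θ i) * ((n : ℝ) * δ i * μ / ((n : ℝ) * σ ^ 2 - δ i * α)) +
            (θ i / ((n : ℝ) + θ i) +
                (n : ℝ) * α * δ i / (((n : ℝ) + θ i) * ((n : ℝ) * σ ^ 2 - δ i * α))) *
              ((∑ j, (n : ℝ) / ((n : ℝ) + θ j) *
                  ((n : ℝ) * δ j / ((n : ℝ) * σ ^ 2 - δ j * α)) * μ) /
                (1 - ((∑ j, θ j / ((n : ℝ) + θ j)) +
                  ∑ j, (n : ℝ) * α * δ j /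
                    (((n : ℝ) + θ j) * ((n : ℝ) * σ ^ 2 - δ j * α))))))
      ↔ (∑ j, θ j / ((n : ℝ) + θ j)) +
          ∑ j, (n : ℝ) * α * δ j / (((n : ℝ) + θ j) * ((n : ℝ) * σ ^ 2 - δ j * α)) < 1 := by
  have hn' : (1 : ℝ) ≤ n := by exact_mod_cast hn
  have hd : ∀ j, 0 < (n : ℝ) * σ ^ 2 - δ j * α := fun j => by
    have : 0 < (n : ℝ) * σ ^ 2 := by positivity
    linarith [hpos j]
  have hw : ∀ j, 0 < (n : ℝ) + θ j := fun j => by linarith [(hθ j).1]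
  have hT := sum_div_natCast_add_lt_one n hn θ hθ
  set T := ∑ j, θ j / ((n : ℝ) + θ j)
  set X := ∑ j, δ j / (((n : ℝ) + θ j) * ((n : ℝ) * σ ^ 2 - δ j * α)) with hX
  have hX0 : 0 ≤ X := Finset.sum_nonneg fun j _ =>
    div_nonneg (hδ j).le (mul_pos (hw j) (hd j)).le
  have hS : ∑ j, (n : ℝ) * α * δ j / (((n : ℝ) + θ j) * ((n : ℝ) * σ ^ 2 - δ j * α))
      = n * α * X := by
    rw [hX, Finset.mul_sum]
    exact Finset.sum_congr rfl fun j _ => mul_div_assoc _ _ _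
  have hA : ∑ j, (n : ℝ) / ((n : ℝ) + θ j) *
      ((n : ℝ) * δ j / ((n : ℝ) * σ ^ 2 - δ j * α)) * μ = n ^ 2 * μ * X := by
    rw [hX, Finset.mul_sum]
    refine Finset.sum_congr rfl fun j _ => ?_
    rw [div_mul_div_comm]
    ring
  rw [hS] at hs ⊢
  rw [hA]
  have h1s : 1 - (T + n * α * X) ≠ 0 := sub_ne_zero.2 hs.symm
  have key : ∀ i, (n : ℝ) / ((n : ℝ) + θ i) * ((n : ℝ) * δ i * μ / ((n : ℝ) * σ ^ 2 - δ i * α)) +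
      (θ i / ((n : ℝ) + θ i) +
        (n : ℝ) * α * δ i / (((n : ℝ) + θ i) * ((n : ℝ) * σ ^ 2 - δ i * α))) *
          (n ^ 2 * μ * X / (1 - (T + n * α * X)))
      = n ^ 2 * μ / ((n : ℝ) + θ i) *
          (δ i / ((n : ℝ) * σ ^ 2 - δ i * α) * (1 - T) + θ i * X) / (1 - (T + n * α * X)) := by
    intro i
    have h1 := (hw i).ne'
    have h2 := (hd i).ne'
    generalize (n : ℝ) * σ ^ 2 - δ i * α = d at h2 ⊢
    generalize hr : 1 - (T + n * α * X) = r at h1s ⊢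
    rw [show 1 - T = r + n * α * X by linarith]
    field_simp
    ring
  have hnum : ∀ i, 0 < n ^ 2 * μ / ((n : ℝ) + θ i) *
      (δ i / ((n : ℝ) * σ ^ 2 - δ i * α) * (1 - T) + θ i * X) := fun i =>
    mul_pos (div_pos (by positivity) (hw i)) (add_pos_of_pos_of_nonneg
      (mul_pos (div_pos (hδ i) (hd i)) (sub_pos.2 hT)) (mul_nonneg (hθ i).1 hX0))
  simp only [key, div_pos_iff_of_pos_left (hnum _), sub_pos]
  exact ⟨fun h => h ⟨0, hn⟩, fun h _ => h⟩
end

section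
/- Assume nσ² − 2δ_jα > 0 for all j = 1,…,n and ŝ(α) ≠ 1, and let π* be the candidate equilibrium. Then the equilibrium drift satisfies μ + (α/n)·Σ_{j=1}^n π_j* = μ·(1 − θ̂)/(1 − ŝ(α)); equivalently, the excess drift satisfies (μ + (α/n)·Σ_{j=1}^n π_j*) − μ = μ·(ŝ(α) − θ̂)/(1 − ŝ(α)). -/
open Finset

/-- Equilibrium drift: with the candidate CARA equilibrium `π*`, the drift satisfies
`μ + (α/n)·Σⱼ πⱼ* = μ·(1 − θ̂)/(1 − ŝ(α))`; equivalently the excess drift is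
`μ·(ŝ(α) − θ̂)/(1 − ŝ(α))`. -/
theorem cara_equilibrium_drift
    (n : ℕ) (hn : 1 ≤ n) (μ σ α : ℝ) (hμ : 0 < μ) (hσ : 0 < σ)
    (δ θ : Fin n → ℝ) (hδ : ∀ i, 0 < δ i) (hθ : ∀ i, 0 ≤ θ i ∧ θ i ≤ 1)
    (hpos : ∀ j, 0 < (n : ℝ) * σ ^ 2 - 2 * δ j * α)
    (hs : (∑ j, θ j / ((n : ℝ) + θ j)) +
        ∑ j, (n : ℝ) * α * δ j / (((n : ℝ) + θ j) * ((n : ℝ) * σ ^ 2 - δ j * α)) ≠ 1)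
    (π : Fin n → ℝ)
    (hπ : π = fun i =>
        (n : ℝ) / ((n : ℝ) + θ i) * ((n : ℝ) * δ i * μ / ((n : ℝ) * σ ^ 2 - δ i * α)) +
          (θ i / ((n : ℝ) + θ i) +
              (n : ℝ) * α * δ i / (((n : ℝ) + θ i) * ((n : ℝ) * σ ^ 2 - δ i * α))) *
            ((∑ j, (n : ℝ) / ((n : ℝ) + θ j) *
                ((n : ℝ) * δ j / ((n : ℝ) * σ ^ 2 - δ j * α)) * μ) /
              (1 - ((∑ j, θ j / ((n : ℝ) + θ j)) +
                ∑ j, (n : ℝ) * α * δ j /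
                  (((n : ℝ) + θ j) * ((n : ℝ) * σ ^ 2 - δ j * α)))))) :
    μ + α / (n : ℝ) * ∑ j, π j =
        μ * (1 - ∑ j, θ j / ((n : ℝ) + θ j)) /
          (1 - ((∑ j, θ j / ((n : ℝ) + θ j)) +
            ∑ j, (n : ℝ) * α * δ j / (((n : ℝ) + θ j) * ((n : ℝ) * σ ^ 2 - δ j * α)))) ∧
      (μ + α / (n : ℝ) * ∑ j, π j) - μ =
        μ * (((∑ j, θ j / ((n : ℝ) + θ j)) +
            ∑ j, (n : ℝ) * α * δ j / (((n : ℝ) + θ j) * ((n : ℝ) * σ ^ 2 - δ j * α))) -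
              ∑ j, θ j / ((n : ℝ) + θ j)) /
          (1 - ((∑ j, θ j / ((n : ℝ) + θ j)) +
            ∑ j, (n : ℝ) * α * δ j / (((n : ℝ) + θ j) * ((n : ℝ) * σ ^ 2 - δ j * α)))) := by
  have hn0 : (n : ℝ) ≠ 0 := by
    have : (0 : ℝ) < n := by exact_mod_cast hn
    exact this.ne'
  have hC : α / (n : ℝ) * (∑ j, (n : ℝ) / ((n : ℝ) + θ j) *
        ((n : ℝ) * δ j / ((n : ℝ) * σ ^ 2 - δ j * α)) * μ) =
      μ * ∑ j, (n : ℝ) * α * δ j / (((n : ℝ) + θ j) * ((n : ℝ) * σ ^ 2 - δ j * α)) := by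
    rw [mul_sum, mul_sum]
    refine sum_congr rfl fun j _ => ?_
    rw [div_mul_div_comm]
    generalize ((n : ℝ) + θ j) * ((n : ℝ) * σ ^ 2 - δ j * α) = D
    calc
      _ = (n : ℝ) / n * (n * α * δ j / D * μ) := by ring
      _ = _ := by rw [div_self hn0]; ring
  have hsum : ∑ j, π j = (∑ j, (n : ℝ) / ((n : ℝ) + θ j) *
        ((n : ℝ) * δ j / ((n : ℝ) * σ ^ 2 - δ j * α)) * μ) +
      ((∑ j, θ j / ((n : ℝ) + θ j)) +
        ∑ j, (n : ℝ) * α * δ j / (((n : ℝ) + θ j) * ((n : ℝ) * σ ^ 2 - δ j * α))) *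
      ((∑ j, (n : ℝ) / ((n : ℝ) + θ j) *
          ((n : ℝ) * δ j / ((n : ℝ) * σ ^ 2 - δ j * α)) * μ) /
        (1 - ((∑ j, θ j / ((n : ℝ) + θ j)) +
          ∑ j, (n : ℝ) * α * δ j /
            (((n : ℝ) + θ j) * ((n : ℝ) * σ ^ 2 - δ j * α))))) := by
    rw [hπ, sum_add_distrib, ← sum_mul, sum_add_distrib]
    congr 1
    exact sum_congr rfl fun j _ => by ring
  rw [hsum]
  generalize (∑ j, (n : ℝ) / ((n : ℝ) + θ j) *
    ((n : ℝ) * δ j / ((n : ℝ) * σ ^ 2 - δ j * α)) * μ) = C at hC ⊢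
  generalize (∑ j, (n : ℝ) * α * δ j /
    (((n : ℝ) + θ j) * ((n : ℝ) * σ ^ 2 - δ j * α))) = B at hs hC ⊢
  generalize (∑ j, θ j / ((n : ℝ) + θ j)) = T at hs ⊢
  have hne : 1 - (T + B) ≠ 0 := sub_ne_zero.mpr hs.symm
  have hdrift : α / (n : ℝ) * (C + (T + B) * (C / (1 - (T + B)))) =
      μ * B / (1 - (T + B)) := by
    rw [← hC, eq_div_iff hne]
    calc
      _ = α / n * (C * (1 - (T + B)) + (T + B) * (C / (1 - (T + B)) * (1 - (T + B)))) := by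
        ring
      _ = _ := by rw [div_mul_cancel₀ _ hne]; ring
  rw [hdrift]
  constructor
  · rw [eq_div_iff hne, add_mul, div_mul_cancel₀ _ hne]
    ring
  · ring
end

section
/- Assume nσ² − 2δ_jα > 0 for all j = 1,…,n and ŝ(α) ≠ 1, and let π* be the candidate equilibrium. Then the equilibrium drift μ + (α/n)·Σ_{j=1}^n π_j* is strictly greater than μ if and only if α > 0 and ŝ(α) < 1; and it is strictly less than μ if and only if α < 0 or ŝ(α) > 1. -/
open Finset

/-- A sum of competition ratios `θ j / (n + θ j)` with weights in `[0, 1]` stays below one. -/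
lemma sum_div_add_lt_one (n : ℕ) (θ : Fin n → ℝ) (hθ : ∀ i, 0 ≤ θ i ∧ θ i ≤ 1) :
    ∑ j, θ j / ((n : ℝ) + θ j) < 1 := by
  have hn0 : (0 : ℝ) < n + 1 := by positivity
  have hle : ∑ j, θ j / ((n : ℝ) + θ j) ≤ ∑ _j : Fin n, 1 / ((n : ℝ) + 1) := by
    refine Finset.sum_le_sum fun j _ => ?_
    have hn : (1 : ℝ) ≤ n := by exact_mod_cast j.pos
    obtain ⟨h0, h1⟩ := hθ j
    rw [div_le_div_iff₀ (by linarith) hn0]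
    nlinarith
  refine hle.trans_lt ?_
  rw [Finset.sum_const, Finset.card_univ, Fintype.card_fin, nsmul_eq_mul, mul_one_div,
    div_lt_one hn0]
  linarith

/-- Comparison of the equilibrium drift with `μ`: the drift obtained from the candidate
CARA equilibrium exceeds `μ` iff `α > 0` and `ŝ(α) < 1`, and is below `μ` iff `α < 0`
or `ŝ(α) > 1`. -/
theorem cara_equilibrium_drift_comparison
    (n : ℕ) (hn : 1 ≤ n) (μ σ α : ℝ) (hμ : 0 < μ) (hσ : 0 < σ)
    (δ θ : Fin n → ℝ) (hδ : ∀ i, 0 < δ i) (hθ : ∀ i, 0 ≤ θ i ∧ θ i ≤ 1)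
    (hpos : ∀ j, 0 < (n : ℝ) * σ ^ 2 - 2 * δ j * α)
    (hs : (∑ j, θ j / ((n : ℝ) + θ j)) +
        ∑ j, (n : ℝ) * α * δ j / (((n : ℝ) + θ j) * ((n : ℝ) * σ ^ 2 - δ j * α)) ≠ 1)
    (π : Fin n → ℝ)
    (hπ : π = fun i =>
        (n : ℝ) / ((n : ℝ) + θ i) * ((n : ℝ) * δ i * μ / ((n : ℝ) * σ ^ 2 - δ i * α)) +
          (θ i / ((n : ℝ) + θ i) +
              (n : ℝ) * α * δ i / (((n : ℝ) + θ i) * ((n : ℝ) * σ ^ 2 - δ i * α))) *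
            ((∑ j, (n : ℝ) / ((n : ℝ) + θ j) *
                ((n : ℝ) * δ j / ((n : ℝ) * σ ^ 2 - δ j * α)) * μ) /
              (1 - ((∑ j, θ j / ((n : ℝ) + θ j)) +
                ∑ j, (n : ℝ) * α * δ j /
                  (((n : ℝ) + θ j) * ((n : ℝ) * σ ^ 2 - δ j * α)))))) :
    (μ < μ + α / (n : ℝ) * ∑ j, π j ↔
        0 < α ∧ (∑ j, θ j / ((n : ℝ) + θ j)) +
          ∑ j, (n : ℝ) * α * δ j / (((n : ℝ) + θ j) * ((n : ℝ) * σ ^ 2 - δ j * α)) < 1) ∧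
      (μ + α / (n : ℝ) * ∑ j, π j < μ ↔
        α < 0 ∨ 1 < (∑ j, θ j / ((n : ℝ) + θ j)) +
          ∑ j, (n : ℝ) * α * δ j / (((n : ℝ) + θ j) * ((n : ℝ) * σ ^ 2 - δ j * α))) := by
  have hn0 : (0 : ℝ) < n := by exact_mod_cast hn
  have hd : ∀ j, 0 < (n : ℝ) * σ ^ 2 - δ j * α := fun j => by
    have : 0 < (n : ℝ) * σ ^ 2 := by positivity
    linarith [hpos j]
  have ht : ∀ j, 0 < (n : ℝ) + θ j := fun j => by linarith [(hθ j).1]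
  set S := (∑ j, θ j / ((n : ℝ) + θ j)) +
    ∑ j, (n : ℝ) * α * δ j / (((n : ℝ) + θ j) * ((n : ℝ) * σ ^ 2 - δ j * α)) with hS
  set P := ∑ j, (n : ℝ) / ((n : ℝ) + θ j) *
    ((n : ℝ) * δ j / ((n : ℝ) * σ ^ 2 - δ j * α)) * μ
  have hPpos : 0 < P := by
    refine Finset.sum_pos (fun j _ => ?_) ⟨⟨0, hn⟩, Finset.mem_univ _⟩
    have := hd j
    have := ht j
    have := hδ j
    positivity
  have hs' : 1 - S ≠ 0 := sub_ne_zero.mpr hs.symm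
  have hsum : ∑ j, π j = P / (1 - S) := by
    have h : ∑ j, π j = P + S * (P / (1 - S)) := by
      rw [hπ, Finset.sum_add_distrib, ← Finset.sum_mul, Finset.sum_add_distrib, ← hS]
      congr 1
      exact Finset.sum_congr rfl fun j _ => by ring
    rw [h]
    field_simp
    ring
  have hlt : α ≤ 0 → S < 1 := fun hα => by
    have h : ∑ j, (n : ℝ) * α * δ j /
        (((n : ℝ) + θ j) * ((n : ℝ) * σ ^ 2 - δ j * α)) ≤ 0 :=
      Finset.sum_nonpos fun j _ => div_nonpos_of_nonpos_of_nonneg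
        (mul_nonpos_of_nonpos_of_nonneg
          (mul_nonpos_of_nonneg_of_nonpos hn0.le hα) (hδ j).le)
        (mul_pos (ht j) (hd j)).le
    linarith [sum_div_add_lt_one n θ hθ]
  have hdrift : α / (n : ℝ) * ∑ j, π j = P / n * (α / (1 - S)) := by
    rw [hsum]
    ring
  have hPn : 0 < P / n := div_pos hPpos hn0
  have hneg : P / n * (α / (1 - S)) < 0 ↔ α / (1 - S) < 0 := smul_neg_iff_of_pos_left hPn
  rw [hdrift, lt_add_iff_pos_right, add_lt_iff_neg_left, mul_pos_iff_of_pos_left hPn,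
    hneg, div_pos_iff, div_neg_iff, sub_pos, sub_neg]
  refine ⟨⟨?_, Or.inl⟩, ?_, ?_⟩
  · rintro (h | ⟨hα, h⟩)
    · exact h
    · exact absurd (hlt hα.le) h.not_gt
  · rintro (⟨-, h⟩ | ⟨h, -⟩)
    · exact Or.inr h
    · exact Or.inl h
  · rintro (h | h)
    · exact Or.inr ⟨h, hlt h.le⟩
    · exact Or.inl ⟨not_le.mp fun hα => (hlt hα).not_gt h, h⟩
end

section
/- Let α_1 < 0, let α_2 > 0 with ŝ(α_2) < 1, and let α_3 satisfy ŝ(α_3) > 1 and nσ² − 2δ_jα_3 > 0 for all j (all of α_1, α_2, α_3 satisfying nσ² − 2δ_jα_k > 0 for every j). Writing D(α) = μ + (α/n)·Σ_{j=1}^n π_j*(α) for the drift obtained from the candidate equilibrium π*(α), one has the strict ordering D(α_3) < D(α_1) < μ < D(α_2). -/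
open Finset

/-- Closed form of the drift: `D(α) = μ (1 - θ̂) / (1 - ŝ(α))` whenever `ŝ(α) ≠ 1`. -/
theorem drift_closed_form {n : ℕ} (hn : 1 ≤ n) (μ σ α : ℝ) (δ θ : Fin n → ℝ)
    (hs : (∑ j, θ j / ((n : ℝ) + θ j)) +
        ∑ j, (n : ℝ) * α * δ j / (((n : ℝ) + θ j) * ((n : ℝ) * σ ^ 2 - δ j * α)) ≠ 1) :
    μ + α / (n : ℝ) *
        ∑ i, ((n : ℝ) / ((n : ℝ) + θ i) * ((n : ℝ) * δ i * μ / ((n : ℝ) * σ ^ 2 - δ i * α)) +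
          (θ i / ((n : ℝ) + θ i) +
              (n : ℝ) * α * δ i / (((n : ℝ) + θ i) * ((n : ℝ) * σ ^ 2 - δ i * α))) *
            ((∑ j, (n : ℝ) / ((n : ℝ) + θ j) *
                ((n : ℝ) * δ j / ((n : ℝ) * σ ^ 2 - δ j * α)) * μ) /
              (1 - ((∑ j, θ j / ((n : ℝ) + θ j)) +
                ∑ j, (n : ℝ) * α * δ j /
                  (((n : ℝ) + θ j) * ((n : ℝ) * σ ^ 2 - δ j * α)))))) =
      μ * (1 - ∑ j, θ j / ((n : ℝ) + θ j)) /
        (1 - ((∑ j, θ j / ((n : ℝ) + θ j)) +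
          ∑ j, (n : ℝ) * α * δ j / (((n : ℝ) + θ j) * ((n : ℝ) * σ ^ 2 - δ j * α)))) := by
  have hn0 : (n : ℝ) ≠ 0 := by positivity
  have hdemand : ∑ i, (n : ℝ) / ((n : ℝ) + θ i) *
        ((n : ℝ) * δ i * μ / ((n : ℝ) * σ ^ 2 - δ i * α)) =
      ∑ j, (n : ℝ) / ((n : ℝ) + θ j) *
        ((n : ℝ) * δ j / ((n : ℝ) * σ ^ 2 - δ j * α)) * μ :=
    Finset.sum_congr rfl fun i _ => by ring
  have hscale : α * ∑ j, (n : ℝ) / ((n : ℝ) + θ j) *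
        ((n : ℝ) * δ j / ((n : ℝ) * σ ^ 2 - δ j * α)) * μ =
      n * μ * ∑ j, (n : ℝ) * α * δ j /
        (((n : ℝ) + θ j) * ((n : ℝ) * σ ^ 2 - δ j * α)) := by
    rw [Finset.mul_sum, Finset.mul_sum]
    refine Finset.sum_congr rfl fun i _ => ?_
    simp only [div_eq_mul_inv, mul_inv]
    ring
  rw [Finset.sum_add_distrib, ← Finset.sum_mul, Finset.sum_add_distrib, hdemand]
  generalize (∑ j, (n : ℝ) / ((n : ℝ) + θ j) *
    ((n : ℝ) * δ j / ((n : ℝ) * σ ^ 2 - δ j * α)) * μ) = A at *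
  generalize (∑ j, (n : ℝ) * α * δ j /
    (((n : ℝ) + θ j) * ((n : ℝ) * σ ^ 2 - δ j * α))) = S at *
  generalize (∑ j, θ j / ((n : ℝ) + θ j)) = t at *
  have h1 : 1 - (t + S) ≠ 0 := sub_ne_zero.mpr hs.symm
  field_simp
  linear_combination hscale

/-- The aggregate competition weight `θ̂` is less than one. -/
theorem sum_competition_lt_one {n : ℕ} (θ : Fin n → ℝ)
    (hθ : ∀ i, 0 ≤ θ i ∧ θ i ≤ 1) : ∑ j, θ j / ((n : ℝ) + θ j) < 1 := by
  have hle : ∀ j, θ j / ((n : ℝ) + θ j) ≤ 1 / ((n : ℝ) + 1) := fun j => by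
    have hn0 : (0 : ℝ) < n := Nat.cast_pos.mpr j.pos
    rw [div_le_div_iff₀ (by linarith [hθ j]) (by linarith)]
    nlinarith [hθ j]
  calc ∑ j, θ j / ((n : ℝ) + θ j) ≤ ∑ _j : Fin n, 1 / ((n : ℝ) + 1) :=
        Finset.sum_le_sum fun j _ => hle j
    _ = n / ((n : ℝ) + 1) := by simp [div_eq_mul_inv]
    _ < 1 := by rw [div_lt_one (by positivity)]; linarith

/-- Ordering of equilibrium drifts: for `α₁ < 0`, `α₂ > 0` with `ŝ(α₂) < 1`, and `α₃`
with `ŝ(α₃) > 1` (all satisfying `nσ² − 2δⱼαₖ > 0`), the drifts `D(α)` obtained from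
the candidate equilibria satisfy `D(α₃) < D(α₁) < μ < D(α₂)`. -/
theorem cara_drift_ordering
    (n : ℕ) (hn : 1 ≤ n) (μ σ : ℝ) (hμ : 0 < μ) (hσ : 0 < σ)
    (δ θ : Fin n → ℝ) (hδ : ∀ i, 0 < δ i) (hθ : ∀ i, 0 ≤ θ i ∧ θ i ≤ 1)
    (D : ℝ → ℝ)
    (hD : ∀ α : ℝ, D α = μ + α / (n : ℝ) *
        ∑ i, ((n : ℝ) / ((n : ℝ) + θ i) * ((n : ℝ) * δ i * μ / ((n : ℝ) * σ ^ 2 - δ i * α)) +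
          (θ i / ((n : ℝ) + θ i) +
              (n : ℝ) * α * δ i / (((n : ℝ) + θ i) * ((n : ℝ) * σ ^ 2 - δ i * α))) *
            ((∑ j, (n : ℝ) / ((n : ℝ) + θ j) *
                ((n : ℝ) * δ j / ((n : ℝ) * σ ^ 2 - δ j * α)) * μ) /
              (1 - ((∑ j, θ j / ((n : ℝ) + θ j)) +
                ∑ j, (n : ℝ) * α * δ j /
                  (((n : ℝ) + θ j) * ((n : ℝ) * σ ^ 2 - δ j * α)))))))
    (α₁ α₂ α₃ : ℝ)
    (hpos₁ : ∀ j, 0 < (n : ℝ) * σ ^ 2 - 2 * δ j * α₁)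
    (hpos₂ : ∀ j, 0 < (n : ℝ) * σ ^ 2 - 2 * δ j * α₂)
    (hpos₃ : ∀ j, 0 < (n : ℝ) * σ ^ 2 - 2 * δ j * α₃)
    (hα₁ : α₁ < 0) (hα₂ : 0 < α₂)
    (hs₂ : (∑ j, θ j / ((n : ℝ) + θ j)) +
        ∑ j, (n : ℝ) * α₂ * δ j / (((n : ℝ) + θ j) * ((n : ℝ) * σ ^ 2 - δ j * α₂)) < 1)
    (hs₃ : 1 < (∑ j, θ j / ((n : ℝ) + θ j)) +
        ∑ j, (n : ℝ) * α₃ * δ j / (((n : ℝ) + θ j) * ((n : ℝ) * σ ^ 2 - δ j * α₃))) :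
    D α₃ < D α₁ ∧ D α₁ < μ ∧ μ < D α₂ := by
  have hn0 : (0 : ℝ) < n := by exact_mod_cast hn
  have hne : (univ : Finset (Fin n)).Nonempty := ⟨⟨0, hn⟩, mem_univ _⟩
  have hden : ∀ α : ℝ, (∀ j, 0 < (n : ℝ) * σ ^ 2 - 2 * δ j * α) →
      ∀ j, 0 < ((n : ℝ) + θ j) * ((n : ℝ) * σ ^ 2 - δ j * α) := fun α h j => by
    have hσ2 : 0 < (n : ℝ) * σ ^ 2 := by positivity
    exact mul_pos (by linarith [hθ j]) (by linarith [h j])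
  have ht := sum_competition_lt_one θ hθ
  have hS₁ : ∑ j, (n : ℝ) * α₁ * δ j /
      (((n : ℝ) + θ j) * ((n : ℝ) * σ ^ 2 - δ j * α₁)) < 0 :=
    Finset.sum_neg (fun j _ => div_neg_of_neg_of_pos
      (mul_neg_of_neg_of_pos (mul_neg_of_pos_of_neg hn0 hα₁) (hδ j)) (hden α₁ hpos₁ j)) hne
  have hS₂ : 0 < ∑ j, (n : ℝ) * α₂ * δ j /
      (((n : ℝ) + θ j) * ((n : ℝ) * σ ^ 2 - δ j * α₂)) :=
    Finset.sum_pos (fun j _ => div_pos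
      (mul_pos (mul_pos hn0 hα₂) (hδ j)) (hden α₂ hpos₂ j)) hne
  have hμt : 0 < μ * (1 - ∑ j, θ j / ((n : ℝ) + θ j)) := mul_pos hμ (by linarith)
  rw [hD α₁, hD α₂, hD α₃, drift_closed_form hn μ σ α₁ δ θ (by linarith),
    drift_closed_form hn μ σ α₂ δ θ hs₂.ne, drift_closed_form hn μ σ α₃ δ θ hs₃.ne']
  refine ⟨?_, ?_, ?_⟩
  · exact (div_neg_of_pos_of_neg hμt (by linarith)).trans (div_pos hμt (by linarith))
  · rw [div_lt_iff₀ (by linarith)]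
    exact mul_lt_mul_of_pos_left (by linarith) hμ
  · rw [lt_div_iff₀ (by linarith)]
    exact mul_lt_mul_of_pos_left (by linarith) hμ
end

section
/- Fix an agent i. For any α, α′ with α < α′ < α_max = nσ²/(2·max_j δ_j) such that either both ŝ(α) < 1 and ŝ(α′) < 1, or both ŝ(α) > 1 and ŝ(α′) > 1, one has π_i*(α) < π_i*(α′); that is, α ↦ π_i*(α) is strictly increasing on each of the two intervals (−∞, α_0) and (α_0, α_max), where α_0 is the unique root of ŝ(α) = 1. -/
open Finset

/-- Cross-multiplied monotonicity of `α ↦ α g_d(α) / g_e(α)` for `g_d(α) = d / (c - d α)`. -/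
lemma impact_ratio_le {c d e α β : ℝ} (hc : 0 < c) (hd : 0 < d) (he : 0 < e) (h : α < β)
    (hdβ : 2 * (d * β) < c) (heβ : 2 * (e * β) < c) :
    α * (d / (c - d * α)) * (e / (c - e * β)) ≤ β * (d / (c - d * β)) * (e / (c - e * α)) := by
  have hdαβ : d * α < d * β := mul_lt_mul_of_pos_left h hd
  have heαβ : e * α < e * β := mul_lt_mul_of_pos_left h he
  have h1 : 0 < c - d * α := by linarith
  have h2 : 0 < c - d * β := by linarith
  have h3 : 0 < c - e * α := by linarith
  have h4 : 0 < c - e * β := by linarith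
  have key : 0 ≤ c ^ 2 - c * e * (α + β) + d * e * α * β := by
    rcases le_total 0 α with hα | hα
    · have hαβ : 0 ≤ d * e * (α * β) := by
        have := hα.trans h.le
        positivity
      have := mul_pos hc (show 0 < c - e * (α + β) by linarith)
      linarith
    · have := mul_pos hc h4
      have := mul_nonneg (mul_nonneg he.le (neg_nonneg.2 hα)) h2.le
      linarith
  rw [mul_assoc, mul_assoc, div_mul_div_comm, div_mul_div_comm, ← mul_div_assoc, ← mul_div_assoc,
    div_le_div_iff₀ (mul_pos h1 h4) (mul_pos h2 h3)]
  have := mul_nonneg (mul_pos (mul_pos hd he) (sub_pos.2 h)).le key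
  linarith

lemma div_sub_mul_lt {c e α β : ℝ} (he : 0 < e) (h : α < β) (heβ : e * β < c) :
    e / (c - e * α) < e / (c - e * β) := by
  have := mul_lt_mul_of_pos_left h he
  exact div_lt_div_of_pos_left he (by linarith) (by linarith)

/-- Cross-multiplied strict monotonicity of `g_e(α) / (K - m α ∑ j, w j * g_{d j}(α))`. -/
lemma div_sub_mul_mul_lt {ι : Type*} [Fintype ι] {c e α β K m : ℝ} {d w : ι → ℝ}
    (hc : 0 < c) (hd : ∀ j, 0 < d j) (hw : ∀ j, 0 ≤ w j) (he : 0 < e) (hK : 0 < K) (hm : 0 ≤ m)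
    (h : α < β) (hdβ : ∀ j, 2 * (d j * β) < c) (heβ : 2 * (e * β) < c) :
    e / (c - e * α) * (K - m * β * ∑ j, w j * (d j / (c - d j * β))) <
      e / (c - e * β) * (K - m * α * ∑ j, w j * (d j / (c - d j * α))) := by
  have hg := mul_lt_mul_of_pos_left (div_sub_mul_lt he h (by linarith : e * β < c)) hK
  have hsum : ∑ j, w j * (α * (d j / (c - d j * α)) * (e / (c - e * β))) ≤
      ∑ j, w j * (β * (d j / (c - d j * β)) * (e / (c - e * α))) :=
    Finset.sum_le_sum fun j _ => mul_le_mul_of_nonneg_left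
      (impact_ratio_le hc (hd j) he h (hdβ j) heβ) (hw j)
  have factor (x y : ℝ) : ∑ j, w j * (x * (d j / (c - d j * x)) * y) =
      x * y * ∑ j, w j * (d j / (c - d j * x)) := by
    rw [Finset.mul_sum]
    exact Finset.sum_congr rfl fun j _ => by ring
  rw [factor, factor] at hsum
  have := mul_le_mul_of_nonneg_left hsum hm
  linarith

/-- The total competition weight `∑ j, θ j / (n + θ j)` is below one. -/
lemma sum_div_card_add_lt_one {n : ℕ} (hn : 0 < n) {θ : Fin n → ℝ}
    (hθ : ∀ j, 0 ≤ θ j ∧ θ j ≤ 1) : ∑ j, θ j / ((n : ℝ) + θ j) < 1 := by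
  have hn' : (0 : ℝ) < n := by exact_mod_cast hn
  have hlt : ∑ j, θ j / ((n : ℝ) + θ j) < ∑ _j : Fin n, 1 / (n : ℝ) := by
    refine Finset.sum_lt_sum_of_nonempty ⟨⟨0, hn⟩, mem_univ _⟩ fun j _ => ?_
    obtain ⟨h0, h1⟩ := hθ j
    rw [div_lt_div_iff₀ (by linarith) hn']
    have := mul_le_mul_of_nonneg_right h1 hn'.le
    rcases h0.eq_or_lt with h | h
    · simp [← h, hn']
    · linarith
  simpa [hn'.ne'] using hlt

/-- Piecewise strict monotonicity of the candidate equilibrium in the price impact: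
for a fixed agent `i`, if `α < α' < α_max` and `ŝ(α), ŝ(α')` are both `< 1` or both
`> 1`, then `πᵢ*(α) < πᵢ*(α')`; i.e. `α ↦ πᵢ*(α)` is strictly increasing on each of
`(−∞, α₀)` and `(α₀, α_max)`. -/
theorem cara_equilibrium_piecewise_increasing
    (n : ℕ) (hn : 2 ≤ n) (μ σ : ℝ) (hμ : 0 < μ) (hσ : 0 < σ)
    (δ θ : Fin n → ℝ) (hδ : ∀ j, 0 < δ j) (hθ : ∀ j, 0 ≤ θ j ∧ θ j ≤ 1)
    (δmax : ℝ) (hδmax : IsGreatest (Set.range δ) δmax)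
    (i : Fin n) (P : ℝ → ℝ)
    (hP : ∀ α : ℝ, P α =
        (n : ℝ) / ((n : ℝ) + θ i) * ((n : ℝ) * δ i * μ / ((n : ℝ) * σ ^ 2 - δ i * α)) +
          (θ i / ((n : ℝ) + θ i) +
              (n : ℝ) * α * δ i / (((n : ℝ) + θ i) * ((n : ℝ) * σ ^ 2 - δ i * α))) *
            ((∑ j, (n : ℝ) / ((n : ℝ) + θ j) *
                ((n : ℝ) * δ j / ((n : ℝ) * σ ^ 2 - δ j * α)) * μ) /
              (1 - ((∑ j, θ j / ((n : ℝ) + θ j)) +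
                ∑ j, (n : ℝ) * α * δ j /
                  (((n : ℝ) + θ j) * ((n : ℝ) * σ ^ 2 - δ j * α))))))
    (α α' : ℝ) (hlt : α < α') (hmax : α' < (n : ℝ) * σ ^ 2 / (2 * δmax))
    (hside :
      ((∑ j, θ j / ((n : ℝ) + θ j)) +
          ∑ j, (n : ℝ) * α * δ j / (((n : ℝ) + θ j) * ((n : ℝ) * σ ^ 2 - δ j * α)) < 1 ∧
        (∑ j, θ j / ((n : ℝ) + θ j)) +
          ∑ j, (n : ℝ) * α' * δ j / (((n : ℝ) + θ j) * ((n : ℝ) * σ ^ 2 - δ j * α')) < 1) ∨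
      (1 < (∑ j, θ j / ((n : ℝ) + θ j)) +
          ∑ j, (n : ℝ) * α * δ j / (((n : ℝ) + θ j) * ((n : ℝ) * σ ^ 2 - δ j * α)) ∧
        1 < (∑ j, θ j / ((n : ℝ) + θ j)) +
          ∑ j, (n : ℝ) * α' * δ j / (((n : ℝ) + θ j) * ((n : ℝ) * σ ^ 2 - δ j * α')))) :
    P α < P α' := by
  have hn' : (0 : ℝ) < n := by exact_mod_cast (by lia : 0 < n)
  have hden (j : Fin n) : 0 < (n : ℝ) + θ j := by linarith [(hθ j).1]
  obtain ⟨⟨k, rfl⟩, hub⟩ := hδmax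
  have hc : 0 < (n : ℝ) * σ ^ 2 := by positivity
  set c : ℝ := (n : ℝ) * σ ^ 2
  have hβ (j : Fin n) : 2 * (δ j * α') < c := by
    rw [lt_div_iff₀ (by linarith [hδ k])] at hmax
    rcases le_total 0 α' with h0 | h0
    · have := mul_le_mul_of_nonneg_right (hub ⟨j, rfl⟩ : δ j ≤ δ k) h0
      linarith
    · linarith [mul_nonneg (hδ j).le (neg_nonneg.2 h0)]
  set w : Fin n → ℝ := fun j => 1 / ((n : ℝ) + θ j) with hw
  have hwpos (j : Fin n) : 0 < w j := one_div_pos.2 (hden j)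
  set T := ∑ j, θ j / ((n : ℝ) + θ j)
  have hK : 0 < 1 - T := sub_pos.2 (sum_div_card_add_lt_one (by lia) hθ)
  set G : ℝ → ℝ := fun x => ∑ j, w j * (δ j / (c - δ j * x)) with hG
  have hS (x : ℝ) : ∑ j, (n : ℝ) * x * δ j / (((n : ℝ) + θ j) * (c - δ j * x)) =
      (n : ℝ) * x * G x := by
    rw [hG, Finset.mul_sum]
    refine Finset.sum_congr rfl fun j _ => ?_
    rw [hw, div_mul_div_comm, one_mul, mul_div_assoc]
  have hnum (x : ℝ) : ∑ j, (n : ℝ) / ((n : ℝ) + θ j) * ((n : ℝ) * δ j / (c - δ j * x)) * μ =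
      (n : ℝ) ^ 2 * G x * μ := by
    rw [hG, Finset.mul_sum, Finset.sum_mul]
    exact Finset.sum_congr rfl fun j _ => by rw [hw]; ring
  rw [hS, hS] at hside
  have hPx (x : ℝ) (hD : 1 - T - (n : ℝ) * x * G x ≠ 0) :
      P x = (n : ℝ) ^ 2 * μ * w i *
        (((1 - T) * (δ i / (c - δ i * x)) + θ i * G x) / (1 - T - (n : ℝ) * x * G x)) := by
    rw [hP, hS, hnum, ← sub_sub, mul_comm ((n : ℝ) + θ i) (c - _), ← div_div,
      mul_div_assoc ((n : ℝ) * x), mul_right_comm (n : ℝ) (δ i) μ, mul_div_assoc ((n : ℝ) * μ)]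
    generalize δ i / (c - δ i * x) = g at *
    have := (hden i).ne'
    simp only [hw]
    field_simp
    ring
  have hcross (j : Fin n) := div_sub_mul_mul_lt hc hδ (fun j => (hwpos j).le) (hδ j) hK hn'.le
    hlt hβ (hβ j)
  have hcrossG : G α * (1 - T - (n : ℝ) * α' * G α') ≤
      G α' * (1 - T - (n : ℝ) * α * G α) := by
    conv_lhs => rw [hG]
    conv_rhs => rw [hG]
    simp only [Finset.sum_mul, mul_assoc (w _)]
    exact Finset.sum_le_sum fun j _ => mul_le_mul_of_nonneg_left (hcross j).le (hwpos j).le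
  have hDD : 0 < (1 - T - (n : ℝ) * α * G α) * (1 - T - (n : ℝ) * α' * G α') := by
    rcases hside with ⟨h1, h2⟩ | ⟨h1, h2⟩
    · exact mul_pos (by linarith) (by linarith)
    · exact mul_pos_of_neg_of_neg (by linarith) (by linarith)
  have hD := left_ne_zero_of_mul hDD.ne'
  have hD' := right_ne_zero_of_mul hDD.ne'
  rw [hPx α hD, hPx α' hD']
  refine mul_lt_mul_of_pos_left ?_ (mul_pos (by positivity) (hwpos i))
  rw [← sub_pos, div_sub_div _ _ hD' hD, mul_comm (1 - T - (n : ℝ) * α' * G α') (1 - T - _)]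
  refine div_pos ?_ hDD
  have h1 := mul_lt_mul_of_pos_left (hcross i) hK
  have h2 := mul_le_mul_of_nonneg_left hcrossG (hθ i).1
  linarith
end

section
/- Let g : ℝ → ℝ satisfy g(x)/x → +∞ both as x → +∞ and as x → −∞. Fix n ≥ 1, μ ∈ ℝ, σ > 0, δ > 0 and constants k, b ∈ ℝ, and define h(π) = (π − k)·(μ + g(π/n + b)) − (σ²/(2δ))·(π − k)². Then h(π) → +∞ as π → +∞ and as π → −∞. Consequently, for every c > 0 and C > 0, the supremum over π ∈ ℝ of −C·exp(−c·h(π)) equals 0 and is not attained at any π ∈ ℝ. -/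
open Filter

/-- If `g(x)/x → ∞` as `x → ∞`, a linear term does not compensate the growth of `g`, and the
product of the remainder with a linear factor tends to infinity. -/
theorem tendsto_mul_superlinear_sub_sq_atTop {g : ℝ → ℝ}
    (hg : Tendsto (fun x => g x / x) atTop atTop) {a : ℝ} (ha : 0 < a) (μ s k b : ℝ) :
    Tendsto (fun x => (x - k) * (μ + g (x / a + b)) - s * (x - k) ^ 2) atTop atTop := by
  have hx : Tendsto (fun x : ℝ => x / a + b) atTop atTop :=
    tendsto_atTop_add_const_right _ _ (tendsto_id.atTop_div_const ha)
  have hfactor : Tendsto (fun y => y * (g y / y + -(s * a)) + (μ + s * (a * b + k)))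
      atTop atTop :=
    tendsto_atTop_add_const_right _ _
      (tendsto_id.atTop_mul_atTop₀ (tendsto_atTop_add_const_right _ _ hg))
  have hlin : Tendsto (fun x : ℝ => x + -k) atTop atTop :=
    tendsto_atTop_add_const_right _ _ tendsto_id
  refine (hlin.atTop_mul_atTop₀ (hfactor.comp hx)).congr' ?_
  filter_upwards [hx.eventually_gt_atTop 0] with x hpos
  have hgy : (x / a + b) * (g (x / a + b) / (x / a + b)) = g (x / a + b) :=
    mul_div_cancel₀ _ hpos.ne'
  have hxa : x / a * a = x := div_mul_cancel₀ _ ha.ne'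
  simp only [Function.comp_apply]
  linear_combination (x - k) * hgy - (x - k) * s * hxa

/-- If `h` tends to `+∞` along some nontrivial filter, then `-C * exp (-c * h)` has supremum `0`
for positive `c` and `C`. -/
theorem iSup_neg_mul_exp_neg_mul_eq_zero {α : Type*} {l : Filter α} [l.NeBot] {h : α → ℝ}
    (hl : Tendsto h l atTop) {c C : ℝ} (hc : 0 < c) (hC : 0 < C) :
    (⨆ x, -C * Real.exp (-c * h x)) = 0 := by
  have : Nonempty α := l.nonempty_of_neBot
  have hlim : Tendsto (fun x => -C * Real.exp (-c * h x)) l (nhds 0) := by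
    have hexp := Real.tendsto_exp_atBot.comp (hl.const_mul_atTop_of_neg (neg_lt_zero.mpr hc))
    simpa using hexp.const_mul (-C)
  refine ciSup_eq_of_forall_le_of_forall_lt_exists_gt (fun x => ?_) (fun w hw => ?_)
  · exact mul_nonpos_of_nonpos_of_nonneg (neg_nonpos.mpr hC.le) (Real.exp_pos _).le
  · exact (hlim.eventually_const_lt hw).exists

/-- Ill-posedness under superlinear price impact: if `g(x)/x → ∞` as `x → ±∞`, then the
drift-variance criterion `h(π) = (π − k)(μ + g(π/n + b)) − (σ²/(2δ))(π − k)²` tends to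
`+∞` as `π → ±∞`; consequently, for all `c, C > 0` the supremum of
`π ↦ −C·exp(−c·h(π))` is `0` and is not attained. -/
theorem cara_superlinear_ill_posed
    (g : ℝ → ℝ)
    (htop : Tendsto (fun x => g x / x) atTop atTop)
    (hbot : Tendsto (fun x => g x / x) atBot atTop)
    (n : ℕ) (hn : 1 ≤ n) (μ : ℝ) (σ δ : ℝ) (hσ : 0 < σ) (hδ : 0 < δ) (k b : ℝ)
    (h : ℝ → ℝ)
    (hh : ∀ π : ℝ, h π = (π - k) * (μ + g (π / n + b)) - σ ^ 2 / (2 * δ) * (π - k) ^ 2) :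
    Tendsto h atTop atTop ∧ Tendsto h atBot atTop ∧
      ∀ c C : ℝ, 0 < c → 0 < C →
        (⨆ π : ℝ, -C * Real.exp (-c * h π)) = 0 ∧
          ∀ π : ℝ, -C * Real.exp (-c * h π) ≠ 0 := by
  have hn' : (0 : ℝ) < n := by exact_mod_cast hn
  have h_top : Tendsto h atTop atTop := by
    rw [funext hh]
    exact tendsto_mul_superlinear_sub_sq_atTop htop hn' μ _ k b
  have h_bot : Tendsto h atBot atTop := by
    have hg : Tendsto (fun x => -g (-x) / x) atTop atTop :=
      (hbot.comp tendsto_neg_atTop_atBot).congr fun x => by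
        simp only [Function.comp_apply, div_neg, neg_div]
    refine ((tendsto_mul_superlinear_sub_sq_atTop hg hn' (-μ) (σ ^ 2 / (2 * δ)) (-k) (-b)).comp
      tendsto_neg_atBot_atTop).congr fun x => ?_
    have harg : -(-x / (n : ℝ) + -b) = x / n + b := by ring
    simp only [Function.comp_apply, hh, harg]
    ring
  refine ⟨h_top, h_bot, fun c C hc hC => ⟨iSup_neg_mul_exp_neg_mul_eq_zero h_top hc hC,
    fun π => mul_ne_zero (neg_ne_zero.mpr hC.ne') (Real.exp_pos _).ne'⟩⟩
end

section
/- Assume (a) (n+θ_i)(nσ² − δ_iα) − nθ_iδ_iσ² ≠ 0 for all i, (b) nσ² − 2δ_iα > 0 for all i, and (c) 1 − Σ_{j=1}^n [(n−θ_j)αδ_j − nθ_j(δ_j−1)σ²]/[(n+θ_j)(nσ² − αδ_j) − nθ_jδ_jσ²] ≠ 0. Then every solution π ∈ ℝⁿ of the CRRA best-response system satisfies Σ_{j=1}^n π_j = (1 − Σ_{j=1}^n [(n−θ_j)αδ_j − nθ_j(δ_j−1)σ²]/[(n+θ_j)(nσ² − αδ_j) − nθ_jδ_jσ²])^{−1}·Σ_{j=1}^n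 n²δ_jμ/[(n+θ_j)(nσ² − δ_jα) − nθ_jδ_jσ²]. -/
open Finset

/-- Aggregate investment in the CRRA equilibrium: every solution of the CRRA
best-response system has the stated total investment. -/
theorem crra_sum_of_equilibrium
    (n : ℕ) (hn : 1 ≤ n) (μ σ α : ℝ) (hμ : 0 < μ) (hσ : 0 < σ)
    (δ θ : Fin n → ℝ) (hδ : ∀ i, 0 < δ i) (hθ : ∀ i, 0 ≤ θ i ∧ θ i ≤ 1)
    (ha : ∀ i, ((n : ℝ) + θ i) * ((n : ℝ) * σ ^ 2 - δ i * α) - (n : ℝ) * θ i * δ i * σ ^ 2 ≠ 0)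
    (hb : ∀ i, 0 < (n : ℝ) * σ ^ 2 - 2 * δ i * α)
    (hc : 1 - ∑ j, (((n : ℝ) - θ j) * α * δ j - (n : ℝ) * θ j * (δ j - 1) * σ ^ 2) /
        (((n : ℝ) + θ j) * ((n : ℝ) * σ ^ 2 - α * δ j) - (n : ℝ) * θ j * δ j * σ ^ 2) ≠ 0)
    (π : Fin n → ℝ)
    (hπ : ∀ i, ((n : ℝ) * σ ^ 2 - 2 * α * δ i) * π i =
        (n : ℝ) * δ i * μ +
          (α * δ i * (1 - θ i / (n : ℝ)) - σ ^ 2 * θ i * (δ i - 1)) *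
            ∑ j ∈ Finset.univ.erase i, π j) :
    ∑ j, π j =
      (1 - ∑ j, (((n : ℝ) - θ j) * α * δ j - (n : ℝ) * θ j * (δ j - 1) * σ ^ 2) /
          (((n : ℝ) + θ j) * ((n : ℝ) * σ ^ 2 - α * δ j) - (n : ℝ) * θ j * δ j * σ ^ 2))⁻¹ *
        ∑ j, (n : ℝ) ^ 2 * δ j * μ /
          (((n : ℝ) + θ j) * ((n : ℝ) * σ ^ 2 - δ j * α) - (n : ℝ) * θ j * δ j * σ ^ 2) := by
  have hn0 : (n : ℝ) ≠ 0 := by exact_mod_cast Nat.one_le_iff_ne_zero.mp hn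
  rw [eq_inv_mul_iff_mul_eq₀ hc, sub_mul, one_mul, Finset.sum_mul, sub_eq_iff_eq_add,
    ← Finset.sum_add_distrib]
  refine Finset.sum_congr rfl fun i _ => ?_
  have hi := hπ i
  have hsum : ∑ j ∈ Finset.univ.erase i, π j = ∑ j, π j - π i :=
    eq_sub_of_add_eq (Finset.sum_erase_add _ _ (Finset.mem_univ i))
  rw [hsum] at hi
  generalize ∑ j, π j = S at hi ⊢
  have hdiv : (n : ℝ) * (θ i / n) = θ i := mul_div_cancel₀ _ hn0
  rw [mul_comm α (δ i), div_mul_eq_mul_div, ← add_div, eq_div_iff (ha i)]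
  linear_combination (n : ℝ) * hi - α * δ i * (S - π i) * hdiv
end

section
/- Fix n ≥ 1, σ > 0, δ > 0, α ∈ ℝ with nσ² − 2αδ > 0, a constant drift μ̃ ∈ ℝ, and a horizon T > 0. Set ρ = −n·μ̃²/(2(nσ² − 2αδ)) and define v(t,y) = −exp(ρ(T − t) − y/δ) for (t,y) ∈ [0,T] × ℝ. Then v satisfies the terminal condition v(T,y) = −exp(−y/δ) for all y, and for all t ∈ [0,T] and y ∈ ℝ the denominator nσ²·∂²_y v(t,y) + 2α·∂_y v(t,y) is nonzero and v solves the reduced Hamilton–Jacobi–Bellman equation ∂_t v(t,y) = (1/2)·n·μ̃²·(∂_y v(t,y))² / (nσ²·∂²_y v(t,y) + 2α·∂_y v(t,y)). -/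
/-- Verification of the exponential ansatz for the auxiliary CARA HJB equation: with
`ρ = −nμ̃²/(2(nσ² − 2αδ))`, the function `v(t,y) = −exp(ρ(T−t) − y/δ)` satisfies the
terminal condition `v(T,y) = −exp(−y/δ)`, has nonvanishing HJB denominator
`nσ²·v_yy + 2α·v_y`, and solves the reduced HJB equation
`v_t = (1/2)·n·μ̃²·v_y²/(nσ²·v_yy + 2α·v_y)` on `[0,T] × ℝ`. -/
theorem cara_hjb_verification
    (n : ℕ) (hn : 1 ≤ n) (σ δ α μt T ρ : ℝ)
    (hσ : 0 < σ) (hδ : 0 < δ) (hT : 0 < T)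
    (hpos : 0 < (n : ℝ) * σ ^ 2 - 2 * α * δ)
    (hρ : ρ = -((n : ℝ) * μt ^ 2) / (2 * ((n : ℝ) * σ ^ 2 - 2 * α * δ)))
    (v : ℝ → ℝ → ℝ)
    (hv : ∀ t y : ℝ, v t y = -Real.exp (ρ * (T - t) - y / δ)) :
    (∀ y : ℝ, v T y = -Real.exp (-y / δ)) ∧
      ∀ t ∈ Set.Icc (0 : ℝ) T, ∀ y : ℝ,
        ((n : ℝ) * σ ^ 2 * deriv (deriv (fun y' => v t y')) y +
            2 * α * deriv (fun y' => v t y') y ≠ 0) ∧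
          deriv (fun t' => v t' y) t =
            1 / 2 * (n : ℝ) * μt ^ 2 * (deriv (fun y' => v t y') y) ^ 2 /
              ((n : ℝ) * σ ^ 2 * deriv (deriv (fun y' => v t y')) y +
                2 * α * deriv (fun y' => v t y') y) := by
  have hy (t y : ℝ) : deriv (fun y' => v t y') y = Real.exp (ρ * (T - t) - y / δ) / δ := by
    simp only [hv]
    have h := (((hasDerivAt_id' y).div_const δ).const_sub (ρ * (T - t))).exp.fun_neg
    rw [h.deriv]
    ring
  have hyy (t y : ℝ) : deriv (deriv (fun y' => v t y')) y =
      -Real.exp (ρ * (T - t) - y / δ) / δ ^ 2 := by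
    rw [funext (hy t)]
    have h := (((hasDerivAt_id' y).div_const δ).const_sub (ρ * (T - t))).exp.div_const δ
    rw [h.deriv]
    ring
  have ht (t y : ℝ) : deriv (fun t' => v t' y) t = ρ * Real.exp (ρ * (T - t) - y / δ) := by
    simp only [hv]
    have h := ((((hasDerivAt_id' t).const_sub T).const_mul ρ).sub_const (y / δ)).exp.fun_neg
    rw [h.deriv]
    ring
  refine ⟨fun y => by rw [hv]; ring_nf, fun t _ y => ?_⟩
  rw [hyy, hy, ht]
  have hE := (Real.exp_pos (ρ * (T - t) - y / δ)).ne'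
  generalize Real.exp (ρ * (T - t) - y / δ) = E at hE ⊢
  have hden : (n : ℝ) * σ ^ 2 * (-E / δ ^ 2) + 2 * α * (E / δ) =
      -(E * ((n : ℝ) * σ ^ 2 - 2 * α * δ) / δ ^ 2) := by
    field_simp
    ring
  have hD := hpos.ne'
  rw [hden, hρ]
  generalize (n : ℝ) * σ ^ 2 - 2 * α * δ = D at hD ⊢
  refine ⟨neg_ne_zero.mpr (by positivity), ?_⟩
  field_simp
end
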